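/- Let h and k be positive integers, and let W be the (finite) set of vectors w ∈ ℤ^k with w ≠ 0, ∑_{i=1}^k w_i = 0, and 1 ≤ ∑_{i : w_i > 0} w_i ≤ h. Then the set of vectors (a_1, …, a_k) ∈ ℝ^k with pairwise distinct coordinates such that {a_1, …, a_k} is not an h-Sidon set is contained in the finite union of hyperplanes ⋃_{w ∈ W} {x ∈ ℝ^k : ∑_{i=1}^k w_i x_i = 0}. -/

import Mathlib

/-- A subset `A` of an additive abelian group is an `h`-Sidon set if whenever two
multisets of cardinality `h` with elements in `A` have equal sums, they are equal. -/
def IsSidonSet {G : Type*} [AddCommGroup G] (h : ℕ) (A : Set G) : Prop :=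
  ∀ s t : Multiset G, (∀ x ∈ s, x ∈ A) → (∀ x ∈ t, x ∈ A) →
    Multiset.card s = h → Multiset.card t = h → s.sum = t.sum → s = t

theorem Multiset.exists_map_eq_of_forall_mem_range {α β : Type*} {f : α → β} (s : Multiset β)
    (hs : ∀ x ∈ s, x ∈ Set.range f) : ∃ S : Multiset α, S.map f = s := by
  lift s to Multiset (Set.range f) using hs
  choose g hg using fun x : Set.range f => x.2
  exact ⟨s.map g, by rw [Multiset.map_map]; exact Multiset.map_congr rfl fun x _ => hg x⟩

theorem Multiset.sum_map_eq_sum_count_mul {ι R : Type*} [Fintype ι] [DecidableEq ι]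
    [CommSemiring R] (S : Multiset ι) (f : ι → R) :
    (S.map f).sum = ∑ i, (S.count i : R) * f i := by
  simp only [← nsmul_eq_mul]
  rw [Finset.sum_multiset_map_count]
  refine Finset.sum_subset (Finset.subset_univ _) fun i _ hi => ?_
  rw [Multiset.count_eq_zero_of_notMem (by simpa using hi), zero_smul]

theorem non_sidon_vectors_subset_union_of_hyperplanes (h k : ℕ) (hh : 0 < h) (hk : 0 < k) :
    {a : Fin k → ℝ | Function.Injective a ∧ ¬ IsSidonSet h (Set.range a)} ⊆
      ⋃ w ∈ {w : Fin k → ℤ | w ≠ 0 ∧ (∑ i, w i) = 0 ∧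
              1 ≤ ∑ i ∈ Finset.univ.filter (fun i => 0 < w i), w i ∧
              (∑ i ∈ Finset.univ.filter (fun i => 0 < w i), w i) ≤ (h : ℤ)},
        {x : Fin k → ℝ | ∑ i, (w i : ℝ) * x i = 0} := by
  rintro a ⟨-, hns⟩
  simp only [IsSidonSet, not_forall] at hns
  obtain ⟨s, t, hs, ht, hsc, htc, hst, hne⟩ := hns
  obtain ⟨S, rfl⟩ := s.exists_map_eq_of_forall_mem_range hs
  obtain ⟨T, rfl⟩ := t.exists_map_eq_of_forall_mem_range ht
  rw [Multiset.card_map] at hsc htc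
  have sum_count (U : Multiset (Fin k)) (hU : U.card = h) : ∑ i, (U.count i : ℤ) = h := by
    simpa [hU] using (U.sum_map_eq_sum_count_mul fun _ => (1 : ℤ)).symm
  have hw0 : (fun i => (S.count i : ℤ) - T.count i) ≠ 0 := by
    refine fun hw => hne (congrArg (Multiset.map a) (Multiset.ext.2 fun i => ?_))
    have := congrFun hw i
    simp only [Pi.zero_apply] at this
    omega
  have hwsum : ∑ i, ((S.count i : ℤ) - T.count i) = 0 := by
    rw [Finset.sum_sub_distrib, sum_count S hsc, sum_count T htc, sub_self]
  simp only [Set.mem_iUnion, Set.mem_ofPred_eq]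
  refine ⟨fun i => (S.count i : ℤ) - T.count i, ⟨hw0, hwsum, ?_, ?_⟩, ?_⟩
  · obtain ⟨j, hj⟩ := Function.ne_iff.1 hw0
    obtain ⟨i, hi, hpos⟩ :=
      Finset.exists_pos_of_sum_zero_of_exists_nonzero _ hwsum ⟨j, Finset.mem_univ j, hj⟩
    exact Int.add_one_le_of_lt <| Finset.sum_pos (fun j hj => (Finset.mem_filter.1 hj).2)
      ⟨i, Finset.mem_filter.2 ⟨hi, hpos⟩⟩
  · calc _ ≤ ∑ i ∈ Finset.univ.filter (fun i => 0 < (S.count i : ℤ) - T.count i),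
            (S.count i : ℤ) := Finset.sum_le_sum fun i _ => by omega
      _ ≤ ∑ i, (S.count i : ℤ) :=
          Finset.sum_le_sum_of_subset_of_nonneg (Finset.filter_subset _ _) fun i _ _ => by omega
      _ = h := sum_count S hsc
  · rw [S.sum_map_eq_sum_count_mul, T.sum_map_eq_sum_count_mul] at hst
    push_cast
    simp only [sub_mul, Finset.sum_sub_distrib, hst, sub_self]
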